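/- arXiv:1509.03685 — 2 statements merged into one kernel-verified Lean document; each statement's English description precedes it below -/
import Mathlib

section
/- Let d ≥ 2 and l ≥ 1 be an integer. Let A : ℝ^d → ℝ be of class C^l with A_α := ∂^α A bounded for every multi-index α with |α| = l, and set M = ∑_{|α|=l} ‖A_α‖_∞. Define P_l(A,x,y) = A(x) − ∑_{|α|<l} (A_α(y)/α!) (x−y)^α and K(x,y) = P_l(A,x,y)/|x−y|^{d+l} for x ≠ y. Then: (i) there is a constant C depending only on d and l such that |K(x,y)| ≤ C M |x−y|^{−d} for all x ≠ y; (ii) there is a constant C depending only on d and l such that |K(x₁,y) − K(x₂,y)| ≤ C M |x₁−x₂| / |x₁−y|^{d+1} whenever |x₁−y| > 2|x₁−x₂|, and |K(x,y₁) − K(x,y₂)| ≤ C M |y₁−y₂| / |x−y₁|^{d+1} whenever |x−y₁| > 2|y₁−y₂|. -/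
open Metric

noncomputable section

/-- Partial derivative in the `i`-th coordinate direction. -/
def pderivCoord (d : ℕ) (i : Fin d) (g : EuclideanSpace ℝ (Fin d) → ℝ) :
    EuclideanSpace ℝ (Fin d) → ℝ :=
  fun x => fderiv ℝ g x (EuclideanSpace.single i 1)

/-- The multi-index partial derivative `∂^α g`. -/
def mderiv (d : ℕ) (α : Fin d → ℕ) (g : EuclideanSpace ℝ (Fin d) → ℝ) :
    EuclideanSpace ℝ (Fin d) → ℝ :=
  ((List.finRange d).flatMap fun i => List.replicate (α i) i).foldr (pderivCoord d) g

/-- The Taylor-type remainder `P_l(A,x,y) = A(x) - ∑_{|α|<l} (∂^α A)(y)/α! · (x-y)^α`. -/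
def Pl (d l : ℕ) (A : EuclideanSpace ℝ (Fin d) → ℝ)
    (x y : EuclideanSpace ℝ (Fin d)) : ℝ :=
  A x - ∑ α ∈ Finset.univ.filter (fun α : Fin d → Fin l => (∑ i, (α i : ℕ)) < l),
    mderiv d (fun i => (α i : ℕ)) A y / (∏ i, (Nat.factorial (α i) : ℝ)) *
      ∏ i, (x i - y i) ^ (α i : ℕ)

/-- `M = ∑_{|α| = l} ‖∂^α A‖_∞`. -/
def sumSupDeriv (d l : ℕ) (A : EuclideanSpace ℝ (Fin d) → ℝ) : ℝ :=
  ∑ α ∈ Finset.univ.filter (fun α : Fin d → Fin (l + 1) => (∑ i, (α i : ℕ)) = l),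
    ⨆ x : EuclideanSpace ℝ (Fin d), |mderiv d (fun i => (α i : ℕ)) A x|

theorem contDiff_pderivCoord {d n : ℕ} {g : EuclideanSpace ℝ (Fin d) → ℝ}
    (hg : ContDiff ℝ (n + 1 : ℕ) g) (i : Fin d) : ContDiff ℝ n (pderivCoord d i g) := by
  have h : ContDiff ℝ n (fderiv ℝ g) := hg.fderiv_right (by norm_cast)
  exact h.clm_apply contDiff_const

theorem contDiff_foldr_pderivCoord {d n : ℕ} {g : EuclideanSpace ℝ (Fin d) → ℝ}
    (L : List (Fin d)) (hg : ContDiff ℝ (n + L.length : ℕ) g) :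
    ContDiff ℝ n (L.foldr (pderivCoord d) g) := by
  induction L generalizing n with
  | nil => simpa using hg
  | cons a L ih =>
    refine contDiff_pderivCoord (ih (n := n + 1) ?_) a
    rwa [List.length_cons, ← add_assoc, add_right_comm] at hg

theorem pderivCoord_comm {d : ℕ} {g : EuclideanSpace ℝ (Fin d) → ℝ}
    (hg : ContDiff ℝ 2 g) (i j : Fin d) :
    pderivCoord d i (pderivCoord d j g) = pderivCoord d j (pderivCoord d i g) := by
  have hd : Differentiable ℝ (fderiv ℝ g) :=
    (hg.fderiv_right (m := 1) (by norm_num)).differentiable (by norm_num)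
  have key : ∀ (a b : Fin d) x, pderivCoord d a (pderivCoord d b g) x =
      fderiv ℝ (fderiv ℝ g) x (EuclideanSpace.single a 1) (EuclideanSpace.single b 1) := by
    intro a b x
    have h := ((hd x).hasFDerivAt.clm_apply
      (hasFDerivAt_const (EuclideanSpace.single b (1 : ℝ)) x)).fderiv
    unfold pderivCoord
    rw [h]
    simp
  funext x
  rw [key, key]
  exact (hg.contDiffAt.isSymmSndFDerivAt (by simp)).eq _ _

theorem foldr_pderivCoord_perm {d : ℕ} {g : EuclideanSpace ℝ (Fin d) → ℝ}
    {L₁ L₂ : List (Fin d)} (h : L₁.Perm L₂) (hg : ContDiff ℝ L₁.length g) :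
    L₁.foldr (pderivCoord d) g = L₂.foldr (pderivCoord d) g := by
  induction h with
  | nil => rfl
  | cons a _ ih =>
    rw [List.foldr_cons, List.foldr_cons, ih (hg.of_le (by simp))]
  | swap a b L =>
    simp only [List.foldr_cons]
    refine pderivCoord_comm (contDiff_foldr_pderivCoord (n := 2) L (hg.of_le ?_)) _ _
    exact_mod_cast (by simp [add_comm 2] : 2 + L.length ≤ (b :: a :: L).length)
  | trans h₁ _ ih₁ ih₂ => rw [ih₁ hg, ih₂ (h₁.length_eq ▸ hg)]

theorem count_flatMap_replicate {d : ℕ} (α : Fin d → ℕ) (j : Fin d) :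
    ((List.finRange d).flatMap fun i => List.replicate (α i) i).count j = α j := by
  rw [List.count_flatMap]
  have : (List.count j ∘ fun i => List.replicate (α i) i) = fun i => if i = j then α i else 0 := by
    funext i
    simp [List.count_replicate]
  rw [this, ← List.ofFn_eq_map, List.sum_ofFn]
  simp

theorem length_flatMap_replicate {d : ℕ} (α : Fin d → ℕ) :
    ((List.finRange d).flatMap fun i => List.replicate (α i) i).length = ∑ i, α i := by
  rw [List.length_flatMap]
  simp only [List.length_replicate]
  rw [← List.ofFn_eq_map, List.sum_ofFn]

theorem mderiv_zero {d : ℕ} (g : EuclideanSpace ℝ (Fin d) → ℝ) :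
    mderiv d 0 g = g := by
  have : ((List.finRange d).flatMap fun i => List.replicate ((0 : Fin d → ℕ) i) i) = [] := by
    simp
  rw [mderiv, this, List.foldr_nil]

theorem mderiv_pderivCoord {d : ℕ} {g : EuclideanSpace ℝ (Fin d) → ℝ} (α : Fin d → ℕ)
    (i : Fin d) (hg : ContDiff ℝ (∑ j, α j + 1 : ℕ) g) :
    mderiv d α (pderivCoord d i g) = mderiv d (α + Pi.single i 1) g := by
  set L := (List.finRange d).flatMap fun j => List.replicate (α j) j with hL
  have h : mderiv d α (pderivCoord d i g) = (L ++ [i]).foldr (pderivCoord d) g := by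
    simp [mderiv, hL]
  rw [h, mderiv]
  refine foldr_pderivCoord_perm ?_
    (by rwa [List.length_append, hL, length_flatMap_replicate, List.length_singleton])
  rw [List.perm_iff_count]
  intro j
  rw [count_flatMap_replicate, List.count_append, hL, count_flatMap_replicate]
  by_cases hij : i = j
  · subst hij; simp
  · simp [hij, Ne.symm hij]

/-- The multi-indices of order less than `l`. -/
def multiIndexLT (d l : ℕ) : Finset (Fin d → ℕ) :=
  (Fintype.piFinset fun _ : Fin d => Finset.range l).filter fun α => ∑ i, α i < l

theorem mem_multiIndexLT {d l : ℕ} {α : Fin d → ℕ} :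
    α ∈ multiIndexLT d l ↔ ∑ i, α i < l := by
  simp only [multiIndexLT, Finset.mem_filter, Fintype.mem_piFinset, Finset.mem_range,
    and_iff_right_iff_imp]
  intro h i
  exact (Finset.single_le_sum (f := α) (fun _ _ => Nat.zero_le _) (Finset.mem_univ i)).trans_lt h

theorem Pl_eq_sum_multiIndexLT (d l : ℕ) (A : EuclideanSpace ℝ (Fin d) → ℝ)
    (x y : EuclideanSpace ℝ (Fin d)) :
    Pl d l A x y = A x - ∑ α ∈ multiIndexLT d l,
      mderiv d α A y / (∏ i, (Nat.factorial (α i) : ℝ)) * ∏ i, (x i - y i) ^ α i := by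
  rw [Pl]
  congr 1
  refine Finset.sum_bij (fun α _ i => (α i : ℕ)) ?_ ?_ ?_ ?_
  · intro α hα
    rw [mem_multiIndexLT]
    exact (Finset.mem_filter.1 hα).2
  · intro α _ β _ h
    funext i
    exact Fin.ext (congrFun h i)
  · intro β hβ
    have hβ' := mem_multiIndexLT.1 hβ
    refine ⟨fun i => ⟨β i, (Finset.single_le_sum (f := β) (fun _ _ => Nat.zero_le _)
      (Finset.mem_univ i)).trans_lt hβ'⟩, ?_, rfl⟩
    simpa using hβ'
  · intro α _
    rfl

theorem Pl_zero (d : ℕ) (A : EuclideanSpace ℝ (Fin d) → ℝ) (x y : EuclideanSpace ℝ (Fin d)) :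
    Pl d 0 A x y = A x := by
  simp [Pl]

theorem Pl_succ_self (d l : ℕ) (A : EuclideanSpace ℝ (Fin d) → ℝ)
    (y : EuclideanSpace ℝ (Fin d)) : Pl d (l + 1) A y y = 0 := by
  rw [Pl_eq_sum_multiIndexLT, Finset.sum_eq_single 0]
  · simp [mderiv_zero]
  · intro α _ hα
    obtain ⟨i, hi⟩ := Function.ne_iff.1 hα
    rw [Finset.prod_eq_zero (f := fun i => (y i - y i) ^ α i) (Finset.mem_univ i)
      (by simpa using hi), mul_zero]
  · intro h
    simp [mem_multiIndexLT] at h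

theorem hasFDerivAt_monomial {d : ℕ} (α : Fin d → ℕ) (x y : EuclideanSpace ℝ (Fin d)) :
    HasFDerivAt (fun x : EuclideanSpace ℝ (Fin d) => ∏ i, (x i - y i) ^ α i)
      (∑ i, (∏ j ∈ Finset.univ.erase i, (x j - y j) ^ α j) •
        ((α i * (x i - y i) ^ (α i - 1)) •
          (EuclideanSpace.proj i : EuclideanSpace ℝ (Fin d) →L[ℝ] ℝ))) x := by
  refine HasFDerivAt.finsetProd fun i _ => ?_
  have h : HasFDerivAt (fun x : EuclideanSpace ℝ (Fin d) => x i - y i)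
      (EuclideanSpace.proj i : EuclideanSpace ℝ (Fin d) →L[ℝ] ℝ) x :=
    (EuclideanSpace.proj i : EuclideanSpace ℝ (Fin d) →L[ℝ] ℝ).hasFDerivAt.sub_const _
  simpa using h.pow (α i)

theorem fderiv_monomial_single {d : ℕ} (α : Fin d → ℕ) (x y : EuclideanSpace ℝ (Fin d))
    (i : Fin d) :
    fderiv ℝ (fun x : EuclideanSpace ℝ (Fin d) => ∏ i, (x i - y i) ^ α i) x
      (EuclideanSpace.single i 1) =
      (∏ j ∈ Finset.univ.erase i, (x j - y j) ^ α j) * (α i * (x i - y i) ^ (α i - 1)) := by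
  rw [(hasFDerivAt_monomial α x y).fderiv, sum_apply,
    Finset.sum_eq_single i]
  · simp
  · intro j _ hj
    simp [hj]
  · simp

theorem differentiable_Pl {d l : ℕ} {A : EuclideanSpace ℝ (Fin d) → ℝ}
    (hA : Differentiable ℝ A) (y : EuclideanSpace ℝ (Fin d)) :
    Differentiable ℝ fun x => Pl d l A x y := by
  simp only [Pl_eq_sum_multiIndexLT]
  exact hA.sub (Differentiable.fun_sum fun α _ => Differentiable.const_mul
    (fun x => (hasFDerivAt_monomial α x y).differentiableAt) _)

theorem fderiv_Pl_succ_single {d l : ℕ} {A : EuclideanSpace ℝ (Fin d) → ℝ}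
    (hA : ContDiff ℝ (l + 1 : ℕ) A) (x y : EuclideanSpace ℝ (Fin d)) (i : Fin d) :
    fderiv ℝ (fun x => Pl d (l + 1) A x y) x (EuclideanSpace.single i 1) =
      Pl d l (pderivCoord d i A) x y := by
  have hAd : Differentiable ℝ A := hA.differentiable (by simp)
  have hmon : ∀ α : Fin d → ℕ, DifferentiableAt ℝ
      (fun x : EuclideanSpace ℝ (Fin d) => ∏ i, (x i - y i) ^ α i) x :=
    fun α => (hasFDerivAt_monomial α x y).differentiableAt
  simp only [Pl_eq_sum_multiIndexLT]
  rw [fderiv_fun_sub (hAd x) (DifferentiableAt.fun_sum fun α _ => (hmon α).const_mul _),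
    fderiv_fun_sum fun α _ => (hmon α).const_mul _, sub_apply,
    sum_apply]
  refine congrArg₂ _ rfl (Eq.symm ?_)
  refine Finset.sum_of_injOn (fun β => β + Pi.single i 1) ?_ ?_ ?_ ?_
  · intro β _ γ _ h
    exact add_right_cancel h
  · intro β hβ
    have := mem_multiIndexLT.1 hβ
    simpa [mem_multiIndexLT, Finset.sum_add_distrib] using this
  · intro α hα hαn
    have hi : α i = 0 := by
      by_contra hi
      have hsub : α - Pi.single i 1 + Pi.single i 1 = α := by
        funext j
        by_cases hj : j = i
        · subst hj
          simp
          omega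
        · simp [hj]
      refine hαn ⟨α - Pi.single i 1, ?_, hsub⟩
      have := mem_multiIndexLT.1 hα
      rw [← hsub] at this
      simpa [mem_multiIndexLT, Finset.sum_add_distrib] using this
    rw [fderiv_const_mul (hmon α), smul_apply, fderiv_monomial_single]
    simp [hi]
  · intro β hβ
    have hβ' := mem_multiIndexLT.1 hβ
    rw [mderiv_pderivCoord β i (hA.of_le (by exact_mod_cast (by omega)))]
    have key : ∀ γ : Fin d → ℕ, γ i = β i + 1 → (∀ j ≠ i, γ j = β j) →
        mderiv d γ A y / (∏ j, (Nat.factorial (β j) : ℝ)) * ∏ j, (x j - y j) ^ β j =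
          fderiv ℝ (fun x : EuclideanSpace ℝ (Fin d) =>
            mderiv d γ A y / (∏ j, (Nat.factorial (γ j) : ℝ)) * ∏ j, (x j - y j) ^ γ j) x
            (EuclideanSpace.single i 1) := by
      intro γ hγi hγ
      rw [fderiv_const_mul (hmon _), smul_apply, fderiv_monomial_single,
        ← Finset.mul_prod_erase _ (fun j => (Nat.factorial (β j) : ℝ)) (Finset.mem_univ i),
        ← Finset.mul_prod_erase _ (fun j => (Nat.factorial (γ j) : ℝ)) (Finset.mem_univ i),
        ← Finset.mul_prod_erase _ (fun j => (x j - y j) ^ β j) (Finset.mem_univ i)]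
      have h₁ : ∏ j ∈ Finset.univ.erase i, (Nat.factorial (γ j) : ℝ) =
          ∏ j ∈ Finset.univ.erase i, (Nat.factorial (β j) : ℝ) :=
        Finset.prod_congr rfl fun j hj => by rw [hγ j (Finset.ne_of_mem_erase hj)]
      have h₂ : ∏ j ∈ Finset.univ.erase i, (x j - y j) ^ γ j =
          ∏ j ∈ Finset.univ.erase i, (x j - y j) ^ β j :=
        Finset.prod_congr rfl fun j hj => by rw [hγ j (Finset.ne_of_mem_erase hj)]
      have h₃ : ∏ j ∈ Finset.univ.erase i, (Nat.factorial (β j) : ℝ) ≠ 0 :=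
        Finset.prod_ne_zero_iff.2 fun j _ => by positivity
      have h₄ : (Nat.factorial (β i) : ℝ) ≠ 0 := by positivity
      have h₅ : ((β i + 1 : ℕ) : ℝ) ≠ 0 := by positivity
      rw [h₁, h₂, hγi, Nat.factorial_succ, Nat.cast_mul, smul_eq_mul, Nat.add_sub_cancel]
      field_simp
    exact key _ (by simp) fun j hj => by simp [hj]

theorem norm_le_of_abs_apply_single_le {d : ℕ} (T : EuclideanSpace ℝ (Fin d) →L[ℝ] ℝ) {B : ℝ}
    (hB : 0 ≤ B) (h : ∀ i, |T (EuclideanSpace.single i 1)| ≤ B) : ‖T‖ ≤ d * B := by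
  refine T.opNorm_le_bound (by positivity) fun v => ?_
  have hv : v = ∑ i, v i • EuclideanSpace.single i (1 : ℝ) := by
    ext j
    simp [Pi.single_apply]
  calc ‖T v‖ = ‖∑ i, v i * T (EuclideanSpace.single i 1)‖ := by
        conv_lhs => rw [hv]
        simp
    _ ≤ ∑ i : Fin d, ‖v‖ * B := by
        refine norm_sum_le_of_le _ fun i _ => ?_
        rw [norm_mul]
        exact mul_le_mul (PiLp.norm_apply_le v i) (h i) (norm_nonneg _) (norm_nonneg _)
    _ = d * B * ‖v‖ := by
        simp
        ring

/-- Mean value inequality on a closed ball, with bounds on the partial derivatives. -/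
theorem abs_sub_le_of_abs_fderiv_single_le {d : ℕ} {f : EuclideanSpace ℝ (Fin d) → ℝ}
    (hf : Differentiable ℝ f) {c : EuclideanSpace ℝ (Fin d)} {R B : ℝ} (hB : 0 ≤ B)
    (h : ∀ z, ‖z - c‖ ≤ R → ∀ i, |fderiv ℝ f z (EuclideanSpace.single i 1)| ≤ B)
    {x₁ x₂ : EuclideanSpace ℝ (Fin d)} (h₁ : ‖x₁ - c‖ ≤ R) (h₂ : ‖x₂ - c‖ ≤ R) :
    |f x₁ - f x₂| ≤ d * B * ‖x₁ - x₂‖ := by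
  refine (convex_closedBall c R).norm_image_sub_le_of_norm_fderiv_le (𝕜 := ℝ)
    (fun z _ => hf z) (fun z hz => ?_) (mem_closedBall_iff_norm.2 h₂) (mem_closedBall_iff_norm.2 h₁)
  exact norm_le_of_abs_apply_single_le _ hB (h z (mem_closedBall_iff_norm.1 hz))

theorem abs_mderiv_pderivCoord_le {d l : ℕ} {A : EuclideanSpace ℝ (Fin d) → ℝ} {M : ℝ}
    (hA : ContDiff ℝ (l + 1 : ℕ) A)
    (hM : ∀ α : Fin d → ℕ, ∑ i, α i = l + 1 → ∀ x, |mderiv d α A x| ≤ M) (i : Fin d)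
    (α : Fin d → ℕ) (hα : ∑ i, α i = l) (x : EuclideanSpace ℝ (Fin d)) :
    |mderiv d α (pderivCoord d i A) x| ≤ M := by
  rw [mderiv_pderivCoord α i (by rwa [hα])]
  exact hM _ (by simp [Finset.sum_add_distrib, hα]) x

theorem abs_Pl_le {d l : ℕ} {A : EuclideanSpace ℝ (Fin d) → ℝ} {M : ℝ} (hM₀ : 0 ≤ M)
    (hA : ContDiff ℝ l A)
    (hM : ∀ α : Fin d → ℕ, ∑ i, α i = l → ∀ x, |mderiv d α A x| ≤ M)
    (x y : EuclideanSpace ℝ (Fin d)) :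
    |Pl d l A x y| ≤ d ^ l * M * ‖x - y‖ ^ l := by
  induction l generalizing A x with
  | zero => simpa [Pl_zero, mderiv_zero] using hM 0 (by simp) x
  | succ l ih =>
    have h := abs_sub_le_of_abs_fderiv_single_le (c := y) (R := ‖x - y‖)
      (B := d ^ l * M * ‖x - y‖ ^ l) (x₁ := x) (x₂ := y)
      (differentiable_Pl (l := l + 1) (hA.differentiable (by simp)) y) (by positivity)
      (fun z hz i => ?_) le_rfl (by simp)
    · rw [Pl_succ_self, sub_zero] at h
      refine h.trans_eq ?_
      ring
    · rw [fderiv_Pl_succ_single hA]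
      refine (ih (contDiff_pderivCoord hA i) (abs_mderiv_pderivCoord_le hA hM i) z).trans ?_
      gcongr

theorem abs_Pl_sub_Pl_left_le {d l : ℕ} {A : EuclideanSpace ℝ (Fin d) → ℝ} {M : ℝ} (hM₀ : 0 ≤ M)
    (hA : ContDiff ℝ (l + 1 : ℕ) A)
    (hM : ∀ α : Fin d → ℕ, ∑ i, α i = l + 1 → ∀ x, |mderiv d α A x| ≤ M)
    {x₁ x₂ y : EuclideanSpace ℝ (Fin d)} {R : ℝ} (h₁ : ‖x₁ - y‖ ≤ R) (h₂ : ‖x₂ - y‖ ≤ R) :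
    |Pl d (l + 1) A x₁ y - Pl d (l + 1) A x₂ y| ≤ d ^ (l + 1) * M * ‖x₁ - x₂‖ * R ^ l := by
  have hR : 0 ≤ R := (norm_nonneg _).trans h₁
  refine (abs_sub_le_of_abs_fderiv_single_le (c := y) (R := R) (B := d ^ l * M * R ^ l)
    (differentiable_Pl (l := l + 1) (hA.differentiable (by simp)) y) (by positivity)
    (fun z hz i => ?_) h₁ h₂).trans_eq (by ring)
  rw [fderiv_Pl_succ_single hA]
  refine (abs_Pl_le hM₀ (contDiff_pderivCoord hA i) (abs_mderiv_pderivCoord_le hA hM i) z y).trans ?_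
  gcongr

theorem abs_Pl_sub_Pl_right_le {d l : ℕ} {A : EuclideanSpace ℝ (Fin d) → ℝ} {M : ℝ} (hM₀ : 0 ≤ M)
    (hA : ContDiff ℝ l A)
    (hM : ∀ α : Fin d → ℕ, ∑ i, α i = l → ∀ x, |mderiv d α A x| ≤ M)
    {x y₁ y₂ : EuclideanSpace ℝ (Fin d)} {R : ℝ} (hR : 0 < R) (h₁ : ‖x - y₁‖ ≤ R)
    (h₂ : ‖y₁ - y₂‖ ≤ R) :
    |Pl d l A x y₁ - Pl d l A x y₂| ≤ l * d ^ l * M * ‖y₁ - y₂‖ * (R ^ l / R) := by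
  induction l generalizing A x with
  | zero => simp [Pl_zero]
  | succ l ih =>
    have hAd : Differentiable ℝ A := hA.differentiable (by simp)
    have hd₁ := differentiable_Pl (l := l + 1) hAd y₁
    have hd₂ := differentiable_Pl (l := l + 1) hAd y₂
    have h := abs_sub_le_of_abs_fderiv_single_le (c := y₁) (R := R)
      (B := l * d ^ l * M * ‖y₁ - y₂‖ * (R ^ l / R)) (x₁ := x) (x₂ := y₁)
      (hd₁.sub hd₂) (by positivity) (fun z hz i => ?_) h₁ (by simpa using hR.le)
    · have h₀ := abs_Pl_le hM₀ hA hM y₁ y₂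
      simp only [Pi.sub_apply, Pl_succ_self, zero_sub, sub_neg_eq_add] at h
      have h₃ : |Pl d (l + 1) A x y₁ - Pl d (l + 1) A x y₂| ≤
          d * (l * d ^ l * M * ‖y₁ - y₂‖ * (R ^ l / R)) * ‖x - y₁‖ +
            d ^ (l + 1) * M * ‖y₁ - y₂‖ ^ (l + 1) := by
        rw [abs_le] at h h₀ ⊢
        constructor <;> linarith
      calc _ ≤ _ := h₃
        _ ≤ d * (l * d ^ l * M * ‖y₁ - y₂‖ * (R ^ l / R)) * R +
            d ^ (l + 1) * M * (‖y₁ - y₂‖ * R ^ l) := by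
          rw [pow_succ' ‖y₁ - y₂‖]
          gcongr
        _ = _ := by
          push_cast
          field_simp
          ring
    · have hsub := fderiv_sub (hd₁ z) (hd₂ z)
      rw [hsub, sub_apply, fderiv_Pl_succ_single hA,
        fderiv_Pl_succ_single hA]
      exact ih (contDiff_pderivCoord hA i) (abs_mderiv_pderivCoord_le hA hM i) hz

theorem abs_div_pow_sub_div_pow_le {d l : ℕ} {p₁ p₂ r₁ r₂ δ B : ℝ} (hB : 0 ≤ B) (hδ : 0 ≤ δ)
    (hr : 2 * δ < r₁) (hrr : |r₁ - r₂| ≤ δ) (hp : |p₁ - p₂| ≤ B * δ * (r₁ ^ l / r₁))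
    (hp₂ : |p₂| ≤ B * r₂ ^ l) :
    |p₁ / r₁ ^ (d + l) - p₂ / r₂ ^ (d + l)| ≤
      (1 + (d + l) * 2 ^ (d + l) * 2 ^ d) * B * δ / r₁ ^ (d + 1) := by
  have hr₁ : 0 < r₁ := by linarith
  obtain ⟨hlo, hhi⟩ := abs_le.1 hrr
  have hr₂ : r₁ / 2 ≤ r₂ := by linarith
  have hr₂' : r₂ ≤ 2 * r₁ := by linarith
  have hr₂pos : 0 < r₂ := by linarith
  have hpow : |r₂ ^ (d + l) - r₁ ^ (d + l)| ≤ (d + l) * δ * (2 ^ (d + l) * r₁ ^ (d + l) / r₁) := by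
    have h := abs_pow_sub_pow_le r₂ r₁ (d + l)
    rcases Nat.eq_zero_or_pos (d + l) with h0 | hpos
    · rw [h0]
      simp
      positivity
    obtain ⟨n, hn⟩ : ∃ n, d + l = n + 1 := ⟨d + l - 1, by omega⟩
    have hcast : ((d : ℝ) + l) = ((n + 1 : ℕ) : ℝ) := by exact_mod_cast hn
    rw [hn, hcast]
    rw [hn] at h
    calc _ ≤ _ := h
      _ ≤ δ * (n + 1 : ℕ) * (2 * r₁) ^ n := by
        rw [Nat.add_sub_cancel, abs_sub_comm r₂ r₁]
        gcongr
        rw [abs_of_pos hr₂pos, abs_of_pos hr₁]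
        exact max_le hr₂' (by linarith)
      _ ≤ δ * (n + 1 : ℕ) * (2 * (2 * r₁) ^ n) := by
        gcongr
        have : 0 ≤ (2 * r₁) ^ n := by positivity
        linarith
      _ = _ := by
        field_simp
        ring
  have hsplit : p₁ / r₁ ^ (d + l) - p₂ / r₂ ^ (d + l) =
      (p₁ - p₂) / r₁ ^ (d + l) +
        p₂ * (r₂ ^ (d + l) - r₁ ^ (d + l)) / (r₁ ^ (d + l) * r₂ ^ (d + l)) := by
    field_simp
    ring
  have hfirst : |(p₁ - p₂) / r₁ ^ (d + l)| ≤ B * δ / r₁ ^ (d + 1) := by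
    rw [abs_div, abs_of_pos (pow_pos hr₁ (d + l))]
    calc _ ≤ B * δ * (r₁ ^ l / r₁) / r₁ ^ (d + l) := by gcongr
      _ = _ := by
        rw [pow_add, pow_add]
        field_simp
  have hsecond : |p₂ * (r₂ ^ (d + l) - r₁ ^ (d + l)) / (r₁ ^ (d + l) * r₂ ^ (d + l))| ≤
      (d + l) * 2 ^ (d + l) * 2 ^ d * B * δ / r₁ ^ (d + 1) := by
    rw [abs_div, abs_mul, abs_of_pos (by positivity : 0 < r₁ ^ (d + l) * r₂ ^ (d + l))]
    calc _ ≤ B * r₂ ^ l * ((d + l) * δ * (2 ^ (d + l) * r₁ ^ (d + l) / r₁)) /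
          (r₁ ^ (d + l) * r₂ ^ (d + l)) := by gcongr
      _ = (d + l) * 2 ^ (d + l) * B * δ / r₁ / r₂ ^ d := by
        rw [pow_add r₂]
        field_simp
      _ ≤ (d + l) * 2 ^ (d + l) * B * δ / r₁ / (r₁ / 2) ^ d := by gcongr
      _ = _ := by
        rw [div_pow, pow_succ]
        field_simp
  rw [hsplit]
  refine (abs_add_le _ _).trans ((add_le_add hfirst hsecond).trans_eq ?_)
  ring

theorem sumSupDeriv_nonneg (d l : ℕ) (A : EuclideanSpace ℝ (Fin d) → ℝ) :
    0 ≤ sumSupDeriv d l A :=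
  Finset.sum_nonneg fun _ _ => Real.iSup_nonneg fun _ => abs_nonneg _

theorem abs_mderiv_le_sumSupDeriv {d l : ℕ} {A : EuclideanSpace ℝ (Fin d) → ℝ}
    (hb : ∀ α : Fin d → ℕ, (∑ i, α i) = l → ∃ M : ℝ, ∀ x, |mderiv d α A x| ≤ M)
    (α : Fin d → ℕ) (hα : ∑ i, α i = l) (x : EuclideanSpace ℝ (Fin d)) :
    |mderiv d α A x| ≤ sumSupDeriv d l A := by
  obtain ⟨M, hM⟩ := hb α hα
  have hlt : ∀ i, α i < l + 1 := fun i => Nat.lt_succ_of_le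
    ((Finset.single_le_sum (f := α) (fun _ _ => Nat.zero_le _) (Finset.mem_univ i)).trans_eq hα)
  let β : Fin d → Fin (l + 1) := fun i => ⟨α i, hlt i⟩
  have hβ : β ∈ Finset.univ.filter (fun α : Fin d → Fin (l + 1) => (∑ i, (α i : ℕ)) = l) := by
    simpa [β] using hα
  have hsup : |mderiv d α A x| ≤ ⨆ x, |mderiv d (fun i => (β i : ℕ)) A x| :=
    le_ciSup (f := fun x => |mderiv d α A x|) ⟨M, by rintro _ ⟨z, rfl⟩; exact hM z⟩ x
  exact hsup.trans (Finset.single_le_sum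
    (f := fun α : Fin d → Fin (l + 1) => ⨆ x, |mderiv d (fun i => (α i : ℕ)) A x|)
    (fun _ _ => Real.iSup_nonneg fun _ => abs_nonneg _) hβ)

theorem bajsanski_coifman_kernel_estimates
    (d : ℕ) (hd : 2 ≤ d) (l : ℕ) (hl : 1 ≤ l) :
    ∃ C : ℝ, 0 < C ∧
      ∀ A : EuclideanSpace ℝ (Fin d) → ℝ,
        ContDiff ℝ (l : ℕ∞) A →
        (∀ α : Fin d → ℕ, (∑ i, α i) = l → ∃ M : ℝ, ∀ x, |mderiv d α A x| ≤ M) →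
        -- size condition (1.8)
        (∀ x y : EuclideanSpace ℝ (Fin d), x ≠ y →
          |Pl d l A x y / ‖x - y‖ ^ (d + l)| ≤
            C * sumSupDeriv d l A / ‖x - y‖ ^ d) ∧
        -- regularity in the first variable (1.9) with δ = 1
        (∀ x₁ x₂ y : EuclideanSpace ℝ (Fin d), ‖x₁ - y‖ > 2 * ‖x₁ - x₂‖ →
          |Pl d l A x₁ y / ‖x₁ - y‖ ^ (d + l) - Pl d l A x₂ y / ‖x₂ - y‖ ^ (d + l)| ≤
            C * sumSupDeriv d l A * ‖x₁ - x₂‖ / ‖x₁ - y‖ ^ (d + 1)) ∧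
        -- regularity in the second variable (1.9) with δ = 1
        (∀ x y₁ y₂ : EuclideanSpace ℝ (Fin d), ‖x - y₁‖ > 2 * ‖y₁ - y₂‖ →
          |Pl d l A x y₁ / ‖x - y₁‖ ^ (d + l) - Pl d l A x y₂ / ‖x - y₂‖ ^ (d + l)| ≤
            C * sumSupDeriv d l A * ‖y₁ - y₂‖ / ‖x - y₁‖ ^ (d + 1)) := by
  obtain ⟨l, rfl⟩ : ∃ k, l = k + 1 := ⟨l - 1, by omega⟩
  set n := l + 1 with hn
  set c : ℝ := (n * 2 ^ n) * d ^ n with hc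
  set q : ℝ := 1 + (d + n) * 2 ^ (d + n) * 2 ^ d with hq
  have hn₁ : (1 : ℝ) ≤ n := by exact_mod_cast hl
  have hd₀ : (0 : ℝ) < d := by exact_mod_cast (by omega : 0 < d)
  have hc₀ : 0 < c := by positivity
  have hq₁ : 1 ≤ q := by
    rw [hq, le_add_iff_nonneg_right]
    positivity
  have h2n : (1 : ℝ) ≤ 2 ^ n := one_le_pow₀ one_le_two
  have hdc : (d : ℝ) ^ n ≤ c :=
    le_mul_of_one_le_left (by positivity) (one_le_mul_of_one_le_of_one_le hn₁ h2n)
  refine ⟨q * c, by positivity, fun A hA hb => ?_⟩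
  have hA' : ContDiff ℝ n A := by exact_mod_cast hA
  have hM := abs_mderiv_le_sumSupDeriv hb
  have hM₀ := sumSupDeriv_nonneg d n A
  set M := sumSupDeriv d n A
  have hsize : ∀ x y, |Pl d n A x y| ≤ c * M * ‖x - y‖ ^ n := fun x y =>
    (abs_Pl_le hM₀ hA' hM x y).trans (by gcongr)
  refine ⟨fun x y hxy => ?_, fun x₁ x₂ y h => ?_, fun x y₁ y₂ h => ?_⟩
  · have hr : 0 < ‖x - y‖ := norm_pos_iff.2 (sub_ne_zero.2 hxy)
    rw [abs_div, abs_of_pos (pow_pos hr _)]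
    calc _ ≤ c * M * ‖x - y‖ ^ n / ‖x - y‖ ^ (d + n) := by
          gcongr
          exact hsize x y
      _ = 1 * c * M / ‖x - y‖ ^ d := by
          rw [pow_add _ d n, one_mul, mul_div_mul_right _ _ (pow_ne_zero _ hr.ne')]
      _ ≤ _ := by gcongr
  · have hr : 0 < ‖x₁ - y‖ := (by positivity : 0 ≤ 2 * ‖x₁ - x₂‖).trans_lt h
    have hrr : |‖x₁ - y‖ - ‖x₂ - y‖| ≤ ‖x₁ - x₂‖ := by
      simpa using abs_norm_sub_norm_le (x₁ - y) (x₂ - y)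
    refine (abs_div_pow_sub_div_pow_le (B := c * M) (by positivity) (norm_nonneg _) h hrr
      ?_ (hsize x₂ y)).trans_eq (by rw [hq]; ring)
    have := (abs_le.1 hrr).1
    refine (abs_Pl_sub_Pl_left_le (R := 2 * ‖x₁ - y‖) hM₀ hA' hM (by linarith)
      (by linarith)).trans ?_
    calc d ^ n * M * ‖x₁ - x₂‖ * (2 * ‖x₁ - y‖) ^ l
        = (2 ^ l * d ^ n) * M * ‖x₁ - x₂‖ * (‖x₁ - y‖ ^ n / ‖x₁ - y‖) := by
          rw [hn, pow_succ ‖x₁ - y‖, mul_pow]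
          field_simp
      _ ≤ _ := by
          gcongr
          refine mul_le_mul_of_nonneg_right ?_ (by positivity)
          calc (2 : ℝ) ^ l ≤ 2 ^ n := pow_le_pow_right₀ one_le_two (by omega)
            _ ≤ n * 2 ^ n := le_mul_of_one_le_left (by positivity) hn₁
  · have hr : 0 < ‖x - y₁‖ := (by positivity : 0 ≤ 2 * ‖y₁ - y₂‖).trans_lt h
    have hrr : |‖x - y₁‖ - ‖x - y₂‖| ≤ ‖y₁ - y₂‖ := by
      simpa [norm_sub_rev y₂ y₁] using abs_norm_sub_norm_le (x - y₁) (x - y₂)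
    refine (abs_div_pow_sub_div_pow_le (B := c * M) (by positivity) (norm_nonneg _) h hrr
      ?_ (hsize x y₂)).trans_eq (by rw [hq]; ring)
    refine (abs_Pl_sub_Pl_right_le hM₀ hA' hM hr le_rfl
      (by linarith [norm_nonneg (y₁ - y₂)])).trans ?_
    gcongr
    exact mul_le_mul_of_nonneg_right (le_mul_of_one_le_right (by positivity) h2n) (by positivity)

end
end

section
/- Let d ≥ 2, δ ∈ (0,1], j ∈ ℤ, and n ≥ 100 an integer; set l_δ(n) = ⌊2δ^{−1} log₂ n⌋ + 2. Let K : ℝ^d × ℝ^d → ℂ satisfy |K(x,y)| ≤ C₀|x−y|^{−d} and the regularity conditions |K(x₁,y) − K(x₂,y)| ≤ C₀|x₁−x₂|^δ/|x₁−y|^{d+δ} whenever |x₁−y| > 2|x₁−x₂| and |K(x,y₁) − K(x,y₂)| ≤ C₀|y₁−y₂|^δ/|x−y₁|^{d+δ} whenever |x−y₁| > 2|y₁−y₂|. Let φ be smooth, supported in {1/2 ≤ |x| ≤ 2}, φ_j(x) = φ(2^{−j}x), K_j(x,y) = φ_j(x−y)K(x,y); let η be a nonnegative radial C_c^∞ function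 supported in the unit ball with integral 1, η_i(x) = 2^{−id}η(2^{−i}x), and K_j^n(x,y) = ∫ η_{j−l_δ(n)}(x−z)K_j(z,y)dz. Then there is a constant C depending only on d, δ, C₀, φ, η such that for all points y, y₀ ∈ ℝ^d with |y − y₀| ≤ 2^{j−n} and all w ∈ ℝ^d: (i) |K_j^n(y + w, y) − K_j^n(y₀ + w, y)| ≤ C n^{2/δ} 2^{−n} 2^{−jd}; and (ii) |K_j^n(y₀ + w, y) − K_j^n(y₀ + w, y₀)| ≤ C (2^{−n} + 2^{−nδ}) 2^{−jd}. -/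
open MeasureTheory Metric Function ENNReal

noncomputable section

/-- `l_δ(n) = ⌊2 δ⁻¹ log₂ n⌋ + 2`. -/
def lDelta (δ : ℝ) (n : ℕ) : ℤ := ⌊2 / δ * Real.logb 2 (n : ℝ)⌋ + 2

/-- The mollified truncated kernel
`K_j^n(x,y) = ∫ η_{j-l_δ(n)}(x-z) φ_j(z-y) K(z,y) dz`. -/
def Kjn (d : ℕ) (δ : ℝ) (j : ℤ) (n : ℕ)
    (φ η : EuclideanSpace ℝ (Fin d) → ℝ)
    (K : EuclideanSpace ℝ (Fin d) → EuclideanSpace ℝ (Fin d) → ℂ)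
    (x y : EuclideanSpace ℝ (Fin d)) : ℂ :=
  ∫ z : EuclideanSpace ℝ (Fin d),
    (((2 : ℝ) ^ ((j - lDelta δ n) * (d : ℤ)))⁻¹ *
        η ((2 : ℝ) ^ (-(j - lDelta δ n)) • (x - z)) *
      φ ((2 : ℝ) ^ (-j) • (z - y))) • K z y

/-- The dilate `a^d η(a •)` of a function `η` of integral one has integral one, also after the
reflection and translation occurring in a convolution. -/
lemma integral_dilate_eq_one {d : ℕ} {η : EuclideanSpace ℝ (Fin d) → ℝ}
    (hηint : ∫ x, η x = 1) {a : ℝ} (ha : 0 < a) (x : EuclideanSpace ℝ (Fin d)) :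
    ∫ z, a ^ d * η (a • (x - z)) = 1 := by
  rw [integral_const_mul, integral_sub_left_eq_self (fun z => η (a • z)) volume x,
    Measure.integral_comp_smul, hηint, finrank_euclideanSpace_fin,
    abs_of_pos (by positivity), smul_eq_mul, mul_one]
  exact mul_inv_cancel₀ (by positivity)

/-- The integrand of the convolution of a dilated bump with a continuous function is integrable. -/
lemma integrable_dilate_smul {d : ℕ} {η : EuclideanSpace ℝ (Fin d) → ℝ} (hη : Continuous η)
    (hηcomp : HasCompactSupport η) {F : EuclideanSpace ℝ (Fin d) → ℂ} (hF : Continuous F)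
    {a : ℝ} (ha : 0 < a) (x : EuclideanSpace ℝ (Fin d)) :
    Integrable (fun z => (a ^ d * η (a • (x - z))) • F z) := by
  apply Continuous.integrable_of_hasCompactSupport
  · fun_prop
  · have h : HasCompactSupport (fun z => η (a • (x - z))) := by
      have := hηcomp.comp_homeomorph
        ((Homeomorph.subLeft x).trans (Homeomorph.smulOfNeZero a ha.ne'))
      exact this
    exact (h.mul_left (f := fun _ => a ^ d)).smul_right (f' := F)

/-- Convolving a bounded function with the dilate of a Lipschitz bump function supported in the
unit ball gives a Lipschitz function. -/
lemma norm_integral_dilate_sub_le {d : ℕ} {η : EuclideanSpace ℝ (Fin d) → ℝ} {L : NNReal}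
    (hL : LipschitzWith L η) (hηcomp : HasCompactSupport η)
    (hηsupp : support η ⊆ closedBall 0 1)
    {F : EuclideanSpace ℝ (Fin d) → ℂ} (hF : Continuous F) {B : ℝ} (hB : ∀ z, ‖F z‖ ≤ B)
    {a : ℝ} (ha : 0 < a) (x x' : EuclideanSpace ℝ (Fin d)) :
    ‖(∫ z, (a ^ d * η (a • (x - z))) • F z) - ∫ z, (a ^ d * η (a • (x' - z))) • F z‖ ≤
      2 * volume.real (ball (0 : EuclideanSpace ℝ (Fin d)) 1) * L * (a * ‖x - x'‖) * B := by
  have hB0 : 0 ≤ B := (norm_nonneg _).trans (hB 0)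
  have hzero : ∀ u z : EuclideanSpace ℝ (Fin d), z ∉ closedBall u a⁻¹ → η (a • (u - z)) = 0 := by
    intro u z hz
    by_contra h
    have h1 := hηsupp h
    rw [mem_closedBall_zero_iff, norm_smul, Real.norm_of_nonneg ha.le] at h1
    apply hz
    rw [mem_closedBall', dist_eq_norm, ← one_div, le_div_iff₀ ha]
    linarith
  rw [← integral_sub (integrable_dilate_smul hL.continuous hηcomp hF ha x)
    (integrable_dilate_smul hL.continuous hηcomp hF ha x')]
  rw [← setIntegral_eq_integral_of_forall_compl_eq_zero
    (s := closedBall x a⁻¹ ∪ closedBall x' a⁻¹)]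
  swap
  · intro z hz
    rw [Set.mem_union, not_or] at hz
    simp [hzero x z hz.1, hzero x' z hz.2]
  have hbound : ∀ z ∈ closedBall x a⁻¹ ∪ closedBall x' a⁻¹,
      ‖(a ^ d * η (a • (x - z))) • F z - (a ^ d * η (a • (x' - z))) • F z‖ ≤
        a ^ d * (L * (a * ‖x - x'‖)) * B := by
    intro z _
    rw [← sub_smul, ← mul_sub, norm_smul, norm_mul, Real.norm_of_nonneg (by positivity)]
    have h := hL.dist_le_mul (a • (x - z)) (a • (x' - z))
    rw [dist_eq_norm, dist_eq_norm, ← smul_sub, sub_sub_sub_cancel_right, norm_smul,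
      Real.norm_of_nonneg ha.le] at h
    gcongr
    exact hB z
  have hfin : volume (closedBall x a⁻¹ ∪ closedBall x' a⁻¹) < ⊤ :=
    ((isCompact_closedBall _ _).union (isCompact_closedBall _ _)).measure_lt_top
  refine (norm_setIntegral_le_of_norm_le_const hfin hbound).trans ?_
  have hvol := measureReal_union_le (μ := volume) (closedBall x a⁻¹) (closedBall x' a⁻¹)
  rw [Measure.addHaar_real_closedBall _ _ (by positivity),
    Measure.addHaar_real_closedBall _ _ (by positivity), finrank_euclideanSpace_fin] at hvol
  refine (mul_le_mul_of_nonneg_left hvol (by positivity)).trans_eq ?_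
  have : a ^ d * a⁻¹ ^ d = 1 := by rw [← mul_pow, mul_inv_cancel₀ ha.ne', one_pow]
  linear_combination
    (2 * volume.real (ball (0 : EuclideanSpace ℝ (Fin d)) 1) * L * (a * ‖x - x'‖) * B) * this

/-- Averaging against the dilate of a nonnegative bump function of integral one does not increase
the distance between two functions. -/
lemma norm_integral_dilate_sub_integral_le {d : ℕ} {η : EuclideanSpace ℝ (Fin d) → ℝ}
    (hη : Continuous η) (hηcomp : HasCompactSupport η) (hηnonneg : ∀ x, 0 ≤ η x)
    (hηint : ∫ x, η x = 1) {F G : EuclideanSpace ℝ (Fin d) → ℂ} (hF : Continuous F)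
    (hG : Continuous G) {B : ℝ} (hB : ∀ z, ‖F z - G z‖ ≤ B) {a : ℝ} (ha : 0 < a)
    (x : EuclideanSpace ℝ (Fin d)) :
    ‖(∫ z, (a ^ d * η (a • (x - z))) • F z) - ∫ z, (a ^ d * η (a • (x - z))) • G z‖ ≤ B := by
  rw [← integral_sub (integrable_dilate_smul hη hηcomp hF ha x)
    (integrable_dilate_smul hη hηcomp hG ha x)]
  have hone := integral_dilate_eq_one hηint ha x
  have hint : Integrable (fun z => a ^ d * η (a • (x - z))) := by
    by_contra h
    rw [integral_undef h] at hone
    exact zero_ne_one hone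
  calc ‖∫ z, ((a ^ d * η (a • (x - z))) • F z - (a ^ d * η (a • (x - z))) • G z)‖
      ≤ ∫ z, a ^ d * η (a • (x - z)) * B := by
        refine norm_integral_le_of_norm_le (hint.mul_const B) (.of_forall fun z => ?_)
        have h0 : 0 ≤ a ^ d * η (a • (x - z)) := mul_nonneg (by positivity) (hηnonneg _)
        rw [← smul_sub, norm_smul, Real.norm_of_nonneg h0]
        exact mul_le_mul_of_nonneg_left (hB z) h0
    _ = B := by rw [integral_mul_const, hone, one_mul]

/-- A Hölder-regular kernel is continuous in its first variable once it is cut off away from the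
diagonal. -/
lemma continuous_cutoff_smul {d : ℕ} {δ C₀ s : ℝ} (hδ : 0 < δ)
    {φ : EuclideanSpace ℝ (Fin d) → ℝ} (hφ : Continuous φ)
    (hφsupp : ∀ x, φ x ≠ 0 → 1 / 2 ≤ ‖x‖) {k : EuclideanSpace ℝ (Fin d) → ℂ}
    {y : EuclideanSpace ℝ (Fin d)}
    (hk : ∀ x₁ x₂, ‖x₁ - y‖ > 2 * ‖x₁ - x₂‖ →
      ‖k x₁ - k x₂‖ ≤ C₀ * ‖x₁ - x₂‖ ^ δ / ‖x₁ - y‖ ^ ((d : ℝ) + δ)) :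
    Continuous fun z => φ (s • (z - y)) • k z := by
  rw [continuous_iff_continuousAt]
  intro z
  by_cases hz : z = y
  · have hcont : Continuous fun v : EuclideanSpace ℝ (Fin d) => ‖s • (v - y)‖ := by fun_prop
    have hnear : ∀ᶠ v in nhds z, ‖s • (v - y)‖ < 1 / 2 :=
      hcont.continuousAt.eventually_lt continuousAt_const (by simp [hz])
    refine ContinuousAt.congr (f := fun _ => (0 : ℂ)) continuousAt_const ?_
    filter_upwards [hnear] with v hv
    have : φ (s • (v - y)) = 0 := by
      by_contra h
      exact absurd (hφsupp _ h) (not_le.mpr hv)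
    rw [this, zero_smul]
  · have hpos : 0 < ‖z - y‖ := norm_pos_iff.mpr (sub_ne_zero.mpr hz)
    have hcont : Continuous fun v : EuclideanSpace ℝ (Fin d) => 2 * ‖z - v‖ := by fun_prop
    have hnear : ∀ᶠ v in nhds z, 2 * ‖z - v‖ < ‖z - y‖ :=
      hcont.continuousAt.eventually_lt continuousAt_const (by simpa using hpos)
    have hlim : Continuous fun v : EuclideanSpace ℝ (Fin d) =>
        C₀ * ‖z - v‖ ^ δ / ‖z - y‖ ^ ((d : ℝ) + δ) := by
      have : Continuous fun v : EuclideanSpace ℝ (Fin d) => ‖z - v‖ ^ δ :=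
        Continuous.rpow_const (by fun_prop) fun _ => Or.inr hδ.le
      fun_prop
    have hkz : ContinuousAt k z := by
      rw [ContinuousAt, tendsto_iff_norm_sub_tendsto_zero]
      refine squeeze_zero' (.of_forall fun _ => norm_nonneg _) ?_
        ((hlim.tendsto z).trans_eq ?_)
      · filter_upwards [hnear] with v hv
        rw [norm_sub_rev]
        exact hk z v hv
      · simp [Real.zero_rpow hδ.ne']
    have hφz : Continuous fun z => φ (s • (z - y)) := by fun_prop
    exact hφz.continuousAt.smul hkz

/-- A kernel of size `C₀ |x - y|^{-d}` is bounded on the support of a cutoff at scale `r`. -/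
lemma norm_cutoff_smul_le {d : ℕ} {C₀ M r : ℝ} (hC₀ : 0 < C₀) (hr : 0 < r)
    {φ : EuclideanSpace ℝ (Fin d) → ℝ} (hM : ∀ x, ‖φ x‖ ≤ M)
    (hφsupp : ∀ x, φ x ≠ 0 → 1 / 2 ≤ ‖x‖)
    {K : EuclideanSpace ℝ (Fin d) → EuclideanSpace ℝ (Fin d) → ℂ}
    (hK : ∀ x y, x ≠ y → ‖K x y‖ ≤ C₀ / ‖x - y‖ ^ d) (z y : EuclideanSpace ℝ (Fin d)) :
    ‖φ (r⁻¹ • (z - y)) • K z y‖ ≤ M * C₀ * 2 ^ d * (r ^ d)⁻¹ := by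
  have hM0 : 0 ≤ M := (norm_nonneg _).trans (hM 0)
  by_cases h : φ (r⁻¹ • (z - y)) = 0
  · rw [h, zero_smul, norm_zero]
    positivity
  have h1 := hφsupp _ h
  rw [norm_smul, Real.norm_of_nonneg (by positivity), inv_mul_eq_div, le_div_iff₀ hr] at h1
  have hzy : z ≠ y := by
    rintro rfl
    rw [sub_self, norm_zero] at h1
    linarith
  rw [norm_smul]
  calc ‖φ (r⁻¹ • (z - y))‖ * ‖K z y‖ ≤ M * (C₀ / (1 / 2 * r) ^ d) := by
        gcongr
        · exact hM _
        · exact (hK z y hzy).trans (by gcongr)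
    _ = M * C₀ * 2 ^ d * (r ^ d)⁻¹ := by
        rw [mul_pow, one_div, inv_pow]
        field_simp

/-- Continuity in the second variable of the kernel cut off at scale `r`, for displacements that
are at most `r / 16`. -/
lemma norm_cutoff_smul_sub_le {d : ℕ} {δ C₀ M r ε : ℝ} (hδ0 : 0 < δ) (hC₀ : 0 < C₀) (hr : 0 < r)
    (hε : ε ≤ 1 / 16) {φ : EuclideanSpace ℝ (Fin d) → ℝ} (hM : ∀ x, ‖φ x‖ ≤ M)
    {L : NNReal} (hL : LipschitzWith L φ) (hφsupp : ∀ x, φ x ≠ 0 → 1 / 2 ≤ ‖x‖)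
    {K : EuclideanSpace ℝ (Fin d) → EuclideanSpace ℝ (Fin d) → ℂ}
    (hK : ∀ x y, x ≠ y → ‖K x y‖ ≤ C₀ / ‖x - y‖ ^ d)
    (hK₂ : ∀ x y₁ y₂, ‖x - y₁‖ > 2 * ‖y₁ - y₂‖ →
      ‖K x y₁ - K x y₂‖ ≤ C₀ * ‖y₁ - y₂‖ ^ δ / ‖x - y₁‖ ^ ((d : ℝ) + δ))
    {y y₀ : EuclideanSpace ℝ (Fin d)} (hy : ‖y - y₀‖ ≤ r * ε) (z : EuclideanSpace ℝ (Fin d)) :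
    ‖φ (r⁻¹ • (z - y)) • K z y - φ (r⁻¹ • (z - y₀)) • K z y₀‖ ≤
      (L * C₀ * 4 ^ d * ε + M * C₀ * 4 ^ ((d : ℝ) + δ) * ε ^ δ) * (r ^ d)⁻¹ := by
  have hM0 : 0 ≤ M := (norm_nonneg _).trans (hM 0)
  have hε0 : 0 ≤ ε := nonneg_of_mul_nonneg_right ((norm_nonneg _).trans hy) hr
  have hfar : ∀ u, φ (r⁻¹ • (z - u)) ≠ 0 → 1 / 2 * r ≤ ‖z - u‖ := by
    intro u h
    have h1 := hφsupp _ h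
    rwa [norm_smul, Real.norm_of_nonneg (by positivity), inv_mul_eq_div, le_div_iff₀ hr] at h1
  have hsmall : ‖y - y₀‖ ≤ r * (1 / 16) := hy.trans (by gcongr)
  by_cases hnear : ‖z - y‖ < 1 / 4 * r
  · have h1 : φ (r⁻¹ • (z - y)) = 0 := by
      by_contra h
      linarith [hfar y h]
    have h2 : φ (r⁻¹ • (z - y₀)) = 0 := by
      by_contra h
      have := norm_sub_le_norm_sub_add_norm_sub z y y₀
      linarith [hfar y₀ h]
    rw [h1, h2, zero_smul, zero_smul, sub_zero, norm_zero]
    positivity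
  rw [not_lt] at hnear
  have hzy : z ≠ y := by
    rintro rfl
    rw [sub_self, norm_zero] at hnear
    linarith
  have hφsub : ‖φ (r⁻¹ • (z - y)) - φ (r⁻¹ • (z - y₀))‖ ≤ L * ε := by
    refine (hL.norm_sub_le _ _).trans ?_
    rw [← smul_sub, _root_.sub_sub_sub_cancel_left, norm_smul, Real.norm_of_nonneg (by positivity),
      norm_sub_rev, inv_mul_eq_div]
    gcongr
    rwa [div_le_iff₀' hr]
  have hKsize : ‖K z y‖ ≤ C₀ * 4 ^ d * (r ^ d)⁻¹ :=
    calc ‖K z y‖ ≤ C₀ / (1 / 4 * r) ^ d := (hK z y hzy).trans (by gcongr)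
      _ = C₀ * 4 ^ d * (r ^ d)⁻¹ := by
        rw [mul_pow, one_div, inv_pow]
        field_simp
  have hKsub : ‖K z y - K z y₀‖ ≤ C₀ * 4 ^ ((d : ℝ) + δ) * ε ^ δ * (r ^ d)⁻¹ :=
    calc ‖K z y - K z y₀‖ ≤ C₀ * (r * ε) ^ δ / (1 / 4 * r) ^ ((d : ℝ) + δ) := by
          refine (hK₂ z y y₀ (by linarith)).trans ?_
          gcongr
      _ = C₀ * 4 ^ ((d : ℝ) + δ) * ε ^ δ * (r ^ d)⁻¹ := by
        rw [Real.mul_rpow hr.le hε0, Real.mul_rpow (by norm_num) hr.le, one_div,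
          Real.inv_rpow (by norm_num), Real.rpow_add hr, Real.rpow_natCast]
        have : (0 : ℝ) < 4 ^ ((d : ℝ) + δ) := by positivity
        have : 0 < r ^ δ := by positivity
        field_simp
  have hsplit : φ (r⁻¹ • (z - y)) • K z y - φ (r⁻¹ • (z - y₀)) • K z y₀ =
      (φ (r⁻¹ • (z - y)) - φ (r⁻¹ • (z - y₀))) • K z y +
        φ (r⁻¹ • (z - y₀)) • (K z y - K z y₀) := by
    rw [sub_smul, smul_sub (φ _) (K z y)]
    abel
  rw [hsplit]
  calc _ ≤ L * ε * (C₀ * 4 ^ d * (r ^ d)⁻¹) +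
          M * (C₀ * 4 ^ ((d : ℝ) + δ) * ε ^ δ * (r ^ d)⁻¹) := by
        refine (norm_add_le _ _).trans ?_
        rw [norm_smul, norm_smul]
        gcongr
        exact hM _
    _ = _ := by ring

/-- `2 ^ l_δ(n) ≤ 4 n ^ (2 / δ)`. -/
lemma two_zpow_lDelta_le (δ : ℝ) {n : ℕ} (hn : 0 < n) :
    (2 : ℝ) ^ lDelta δ n ≤ 4 * (n : ℝ) ^ (2 / δ) := by
  have hn' : (0 : ℝ) < n := by exact_mod_cast hn
  rw [lDelta, zpow_add₀ two_ne_zero, mul_comm, ← Real.rpow_intCast 2 ⌊_⌋]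
  calc (2 : ℝ) ^ (2 : ℤ) * 2 ^ ((⌊2 / δ * Real.logb 2 n⌋ : ℤ) : ℝ)
      ≤ 4 * 2 ^ (2 / δ * Real.logb 2 n) := by
        gcongr
        · norm_num
        · norm_num
        · exact Int.floor_le _
    _ = 4 * (n : ℝ) ^ (2 / δ) := by
        rw [mul_comm (2 / δ), Real.rpow_mul two_pos.le, Real.rpow_logb two_pos (by norm_num) hn']

/-- The mollified kernel as the convolution of a dilated bump with the cut-off kernel. -/
lemma Kjn_eq_integral_dilate (d : ℕ) (δ : ℝ) (j : ℤ) (n : ℕ)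
    (φ η : EuclideanSpace ℝ (Fin d) → ℝ)
    (K : EuclideanSpace ℝ (Fin d) → EuclideanSpace ℝ (Fin d) → ℂ)
    (x y : EuclideanSpace ℝ (Fin d)) :
    Kjn d δ j n φ η K x y =
      ∫ z, (((2 : ℝ) ^ (-(j - lDelta δ n))) ^ d * η ((2 : ℝ) ^ (-(j - lDelta δ n)) • (x - z))) •
        (φ (((2 : ℝ) ^ j)⁻¹ • (z - y)) • K z y) := by
  simp only [Kjn, smul_smul, zpow_neg, zpow_mul, zpow_natCast, inv_pow]

theorem mollified_kernel_continuity_estimates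
    (d : ℕ) (hd : 2 ≤ d) (δ : ℝ) (hδ0 : 0 < δ) (hδ1 : δ ≤ 1)
    (C₀ : ℝ) (hC₀ : 0 < C₀)
    (φ : EuclideanSpace ℝ (Fin d) → ℝ) (hφ : ContDiff ℝ (⊤ : ℕ∞) φ)
    (hφsupp : support φ ⊆ {x : EuclideanSpace ℝ (Fin d) | 1 / 2 ≤ ‖x‖ ∧ ‖x‖ ≤ 2})
    (η : EuclideanSpace ℝ (Fin d) → ℝ) (hη : ContDiff ℝ (⊤ : ℕ∞) η)
    (hηcomp : HasCompactSupport η) (hηnonneg : ∀ x, 0 ≤ η x)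
    (hηradial : ∀ x y : EuclideanSpace ℝ (Fin d), ‖x‖ = ‖y‖ → η x = η y)
    (hηsupp : support η ⊆ closedBall 0 1)
    (hηint : ∫ x, η x = 1) :
    ∃ C : ℝ, 0 < C ∧
      ∀ (j : ℤ) (n : ℕ), 100 ≤ n →
      ∀ K : EuclideanSpace ℝ (Fin d) → EuclideanSpace ℝ (Fin d) → ℂ,
        -- size condition (1.8)
        (∀ x y, x ≠ y → ‖K x y‖ ≤ C₀ / ‖x - y‖ ^ d) →
        -- regularity conditions (1.9)
        (∀ x₁ x₂ y, ‖x₁ - y‖ > 2 * ‖x₁ - x₂‖ →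
          ‖K x₁ y - K x₂ y‖ ≤ C₀ * ‖x₁ - x₂‖ ^ δ / ‖x₁ - y‖ ^ ((d : ℝ) + δ)) →
        (∀ x y₁ y₂, ‖x - y₁‖ > 2 * ‖y₁ - y₂‖ →
          ‖K x y₁ - K x y₂‖ ≤ C₀ * ‖y₁ - y₂‖ ^ δ / ‖x - y₁‖ ^ ((d : ℝ) + δ)) →
      ∀ y y₀ w : EuclideanSpace ℝ (Fin d),
        ‖y - y₀‖ ≤ (2 : ℝ) ^ (j - (n : ℤ)) →
        -- (4.14): continuity in the first variable
        ‖Kjn d δ j n φ η K (y + w) y - Kjn d δ j n φ η K (y₀ + w) y‖ ≤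
            C * (n : ℝ) ^ (2 / δ) * (2 : ℝ) ^ (-(n : ℝ)) *
              ((2 : ℝ) ^ (j * (d : ℤ)))⁻¹ ∧
        -- (4.15): continuity in the second variable
        ‖Kjn d δ j n φ η K (y₀ + w) y - Kjn d δ j n φ η K (y₀ + w) y₀‖ ≤
            C * ((2 : ℝ) ^ (-(n : ℝ)) + (2 : ℝ) ^ (-(n : ℝ) * δ)) *
              ((2 : ℝ) ^ (j * (d : ℤ)))⁻¹ := by
  have hφball : ∀ x, φ x ≠ 0 → 1 / 2 ≤ ‖x‖ := fun x hx => (hφsupp hx).1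
  have hφcomp : HasCompactSupport φ :=
    HasCompactSupport.intro (isCompact_closedBall 0 2) fun x hx => by
      by_contra h
      exact hx (mem_closedBall_zero_iff.mpr (hφsupp h).2)
  obtain ⟨M, hM⟩ := hφcomp.exists_bound_of_continuous hφ.continuous
  obtain ⟨A, hA⟩ := hφ.lipschitzWith_of_hasCompactSupport hφcomp (by simp)
  obtain ⟨L, hL⟩ := hη.lipschitzWith_of_hasCompactSupport hηcomp (by simp)
  have hM0 : 0 ≤ M := (norm_nonneg _).trans (hM 0)
  set V := volume.real (ball (0 : EuclideanSpace ℝ (Fin d)) 1)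
  have hV0 : 0 ≤ V := measureReal_nonneg
  set D₁ := 2 * V * L * 4 * (M * C₀ * 2 ^ d) with hD₁
  set D₂ := A * C₀ * 4 ^ d
  set D₃ := M * C₀ * 4 ^ ((d : ℝ) + δ)
  have hD₁0 : 0 ≤ D₁ := by positivity
  have hD₂0 : 0 ≤ D₂ := by positivity
  have hD₃0 : 0 ≤ D₃ := by positivity
  refine ⟨D₁ + D₂ + D₃ + 1, by positivity, ?_⟩
  intro j n hn K hK hK₁ hK₂ y y₀ w hy
  have hr : (0 : ℝ) < 2 ^ j := by positivity
  have ha : (0 : ℝ) < 2 ^ (-(j - lDelta δ n)) := by positivity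
  have hε : (2 : ℝ) ^ (-(n : ℝ)) ≤ 1 / 16 := by
    calc (2 : ℝ) ^ (-(n : ℝ)) ≤ 2 ^ (-(4 : ℝ)) := by
          gcongr
          · norm_num
          · exact_mod_cast (by omega : 4 ≤ n)
      _ = 1 / 16 := by
          rw [Real.rpow_neg two_pos.le]
          norm_num
  have hy' : ‖y - y₀‖ ≤ 2 ^ j * (2 : ℝ) ^ (-(n : ℝ)) := by
    rwa [Real.rpow_neg two_pos.le, Real.rpow_natCast, ← div_eq_mul_inv, ← zpow_natCast,
      ← zpow_sub₀ two_ne_zero]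
  have hcont : ∀ u, Continuous fun z => φ (((2 : ℝ) ^ j)⁻¹ • (z - u)) • K z u := fun u =>
    continuous_cutoff_smul hδ0 hφ.continuous hφball fun x₁ x₂ => hK₁ x₁ x₂ u
  simp only [Kjn_eq_integral_dilate]
  rw [zpow_mul, zpow_natCast]
  constructor
  · have hstep : (2 : ℝ) ^ (-(j - lDelta δ n)) * ‖y + w - (y₀ + w)‖ ≤
        4 * (n : ℝ) ^ (2 / δ) * 2 ^ (-(n : ℝ)) := by
      rw [add_sub_add_right_eq_sub]
      calc (2 : ℝ) ^ (-(j - lDelta δ n)) * ‖y - y₀‖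
          ≤ 2 ^ (-(j - lDelta δ n)) * (2 ^ j * (2 : ℝ) ^ (-(n : ℝ))) := by gcongr
        _ = 2 ^ lDelta δ n * (2 : ℝ) ^ (-(n : ℝ)) := by
          rw [← mul_assoc, ← zpow_add₀ two_ne_zero]
          congr 2
          ring
        _ ≤ _ := by
          gcongr
          exact two_zpow_lDelta_le δ (by omega)
    calc _ ≤ 2 * V * L * (2 ^ (-(j - lDelta δ n)) * ‖y + w - (y₀ + w)‖) *
            (M * C₀ * 2 ^ d * (((2 : ℝ) ^ j) ^ d)⁻¹) :=
          norm_integral_dilate_sub_le hL hηcomp hηsupp (hcont y)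
            (fun z => norm_cutoff_smul_le hC₀ hr hM hφball hK z y) ha _ _
      _ ≤ 2 * V * L * (4 * (n : ℝ) ^ (2 / δ) * 2 ^ (-(n : ℝ))) *
            (M * C₀ * 2 ^ d * (((2 : ℝ) ^ j) ^ d)⁻¹) := by gcongr
      _ = D₁ * (n : ℝ) ^ (2 / δ) * 2 ^ (-(n : ℝ)) * (((2 : ℝ) ^ j) ^ d)⁻¹ := by
          rw [hD₁]
          ring
      _ ≤ _ := by
          gcongr
          linarith
  · refine (norm_integral_dilate_sub_integral_le hη.continuous hηcomp hηnonneg hηint (hcont y)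
      (hcont y₀) (fun z => norm_cutoff_smul_sub_le hδ0 hC₀ hr hε hM hA hφball hK hK₂ hy' z)
      ha _).trans ?_
    rw [← Real.rpow_mul two_pos.le, mul_add]
    gcongr
    · linarith
    · linarith

end
end
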